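/- Let Ω ⊂⊂ ℂⁿ be a bounded pseudoconvex domain with C^k (k ≥ 3)-smooth boundary. Let η be any purely imaginary, non-vanishing 1-form on ∂Ω that annihilates T^{1,0}(∂Ω) ⊕ T^{0,1}(∂Ω), let T_η be the unique purely imaginary tangential vector field orthogonal to T^{1,0}(∂Ω) ⊕ T^{0,1}(∂Ω) with η(T_η) ≡ 1, and set α_η := −Lie_{T_η} η. Then there exists a defining function ρ of Ω such that α_ρ = α_η; in particular, the two definitions of D'Angelo 1-forms (with and without reference to a defining function) are equivalent. -/

import Mathlib

open Complex
open scoped ComplexOrder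

noncomputable section

/-- Points of ℂⁿ. -/
abbrev Pt (n : ℕ) := Fin n → ℂ

/-- Wirtinger derivative ∂f/∂z_j at z (junk value if f is not differentiable). -/
def dZ (n : ℕ) (f : Pt n → ℂ) (j : Fin n) (z : Pt n) : ℂ :=
  (1 / 2 : ℂ) * (fderiv ℝ f z (Pi.single j 1) - Complex.I * fderiv ℝ f z (Pi.single j Complex.I))

/-- Wirtinger derivative ∂f/∂z̄_j at z. -/
def dZb (n : ℕ) (f : Pt n → ℂ) (j : Fin n) (z : Pt n) : ℂ :=
  (1 / 2 : ℂ) * (fderiv ℝ f z (Pi.single j 1) + Complex.I * fderiv ℝ f z (Pi.single j Complex.I))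

/-- Complexification of a real-valued function. -/
def cR (n : ℕ) (ρ : Pt n → ℝ) : Pt n → ℂ := fun z => (ρ z : ℂ)

/-- Levi form of ρ at z: Levi_ρ(X,Y) = Σ_{j,k} ∂²ρ/∂z_j∂z̄_k X_j conj(Y_k), where X, Y are
(1,0)-vectors given by their coefficient tuples. -/
def levi (n : ℕ) (ρ : Pt n → ℝ) (z : Pt n) (X Y : Fin n → ℂ) : ℂ :=
  ∑ j, ∑ k, dZ n (fun w => dZb n (cR n ρ) k w) j z * X j * (starRingEnd ℂ) (Y k)

/-- Holomorphic tangent space T^{1,0}_p(∂Ω) (for boundary points p), described via a defining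
function: (1,0)-vectors X with Σ_j X_j ∂ρ/∂z_j(p) = 0. -/
def T10 (n : ℕ) (ρ : Pt n → ℝ) (p : Pt n) : Set (Fin n → ℂ) :=
  {X | ∑ j, X j * dZ n (cR n ρ) j p = 0}

/-- Null space of the Levi form inside T^{1,0}_p(∂Ω). -/
def nullSp (n : ℕ) (ρ : Pt n → ℝ) (p : Pt n) : Set (Fin n → ℂ) :=
  {X | X ∈ T10 n ρ p ∧ ∀ Y ∈ T10 n ρ p, levi n ρ p X Y = 0}

/-- ρ is a C^s defining function of Ω on the neighborhood V of the closure of Ω. -/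
def IsDefining (n : ℕ) (s : ℕ∞) (Ω : Set (Pt n)) (ρ : Pt n → ℝ) (V : Set (Pt n)) : Prop :=
  IsOpen V ∧ closure Ω ⊆ V ∧ ContDiffOn ℝ s ρ V ∧
    Ω = {z | z ∈ V ∧ ρ z < 0} ∧ ∀ z ∈ frontier Ω, fderiv ℝ ρ z ≠ 0

/-- Strict plurisubharmonicity on a set, via positivity of the Levi form. -/
def StrictPSHOn (n : ℕ) (f : Pt n → ℝ) (s : Set (Pt n)) : Prop :=
  ∀ z ∈ s, ∀ X : Fin n → ℂ, X ≠ 0 → 0 < (levi n f z X X).re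

/-- Diederich–Fornaess exponent of a defining function ρ (0 if the defining set is empty). -/
def DFexp (n : ℕ) (ρ : Pt n → ℝ) (Ω : Set (Pt n)) : ℝ :=
  sSup {η : ℝ | 0 < η ∧ η < 1 ∧ StrictPSHOn n (fun z => -((-ρ z) ^ η)) Ω}

/-- Diederich–Fornaess index of Ω: supremum over all (C¹) defining functions. -/
def DFindex (n : ℕ) (Ω : Set (Pt n)) : ℝ :=
  sSup {e : ℝ | ∃ ρ V, IsDefining n 1 Ω ρ V ∧ e = DFexp n ρ Ω}

/-- Steinness exponent of a defining function ρ (⊤ = ∞ if the defining set is empty). -/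
def Sexp (n : ℕ) (ρ : Pt n → ℝ) (Ω : Set (Pt n)) : EReal :=
  sInf {e : EReal | ∃ η : ℝ, 1 < η ∧
    (∃ U : Set (Pt n), IsOpen U ∧ frontier Ω ⊆ U ∧
      StrictPSHOn n (fun z => ρ z ^ η) ((closure Ω)ᶜ ∩ U)) ∧ e = (η : EReal)}

/-- Steinness index of Ω: infimum over all (C¹) defining functions. -/
def Sindex (n : ℕ) (Ω : Set (Pt n)) : EReal :=
  sInf {e : EReal | ∃ ρ V, IsDefining n 1 Ω ρ V ∧ e = Sexp n ρ Ω}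

/-- A complex vector field Σ_j a_j ∂/∂z_j + Σ_j b_j ∂/∂z̄_j on ℂⁿ, recorded by its
coefficient functions. -/
structure VF (n : ℕ) where
  a : Pt n → Fin n → ℂ
  b : Pt n → Fin n → ℂ

/-- Action of a complex vector field on a function. -/
def VF.app {n : ℕ} (V : VF n) (f : Pt n → ℂ) (z : Pt n) : ℂ :=
  ∑ j, V.a z j * dZ n f j z + ∑ j, V.b z j * dZb n f j z

/-- The value of a vector field at a point, as a pair ((1,0)-part, (0,1)-part). -/
def VF.atPt {n : ℕ} (V : VF n) (p : Pt n) : (Fin n → ℂ) × (Fin n → ℂ) := (V.a p, V.b p)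

/-- A complex 1-form Σ_j w_j dz_j + Σ_j t_j dz̄_j on ℂⁿ. -/
structure Form1 (n : ℕ) where
  w : Pt n → Fin n → ℂ
  t : Pt n → Fin n → ℂ

/-- Value of a 1-form at a point on a complex tangent vector (pair of (1,0) and (0,1) parts). -/
def Form1.eval {n : ℕ} (η : Form1 n) (z : Pt n) (X : (Fin n → ℂ) × (Fin n → ℂ)) : ℂ :=
  ∑ j, η.w z j * X.1 j + ∑ j, η.t z j * X.2 j

/-- Pairing of a 1-form with a vector field. -/
def Form1.app {n : ℕ} (η : Form1 n) (V : VF n) (z : Pt n) : ℂ :=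
  η.eval z (V.atPt z)

/-- Lie bracket of complex vector fields. -/
def VF.bracket {n : ℕ} (V W : VF n) : VF n :=
  ⟨fun z j => V.app (fun w => W.a w j) z - W.app (fun w => V.a w j) z,
   fun z j => V.app (fun w => W.b w j) z - W.app (fun w => V.b w j) z⟩

/-- Levi-Civita covariant derivative ∇_V W of the Euclidean metric (componentwise derivative). -/
def covD {n : ℕ} (V W : VF n) : VF n :=
  ⟨fun z j => V.app (fun w => W.a w j) z, fun z j => V.app (fun w => W.b w j) z⟩

/-- Lie derivative of a 1-form along a vector field, in coordinates. -/
def lieD {n : ℕ} (T : VF n) (η : Form1 n) : Form1 n :=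
  ⟨fun z j => T.app (fun w => η.w w j) z + ∑ m, η.w z m * dZ n (fun w => T.a w m) j z
      + ∑ m, η.t z m * dZ n (fun w => T.b w m) j z,
   fun z j => T.app (fun w => η.t w j) z + ∑ m, η.w z m * dZb n (fun w => T.a w m) j z
      + ∑ m, η.t z m * dZb n (fun w => T.b w m) j z⟩

/-- Negation of a 1-form. -/
def Form1.neg {n : ℕ} (η : Form1 n) : Form1 n := ⟨fun z j => -η.w z j, fun z j => -η.t z j⟩

/-- Σ_j |∂ρ/∂z_j|². -/
def gradSq (n : ℕ) (ρ : Pt n → ℝ) (z : Pt n) : ℝ :=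
  ∑ j, Complex.normSq (dZ n (cR n ρ) j z)

/-- Norm of the real gradient of ρ: ‖∇ρ‖ = 2 (Σ_j |∂ρ/∂z_j|²)^{1/2}. -/
def gradNorm (n : ℕ) (ρ : Pt n → ℝ) (z : Pt n) : ℝ := 2 * Real.sqrt (gradSq n ρ z)

/-- The (1,0) field L_n = (Σ|∂ρ/∂z_j|²)⁻¹ Σ_j (∂ρ/∂z̄_j) ∂/∂z_j. -/
def LnVF (n : ℕ) (ρ : Pt n → ℝ) : VF n :=
  ⟨fun z j => dZb n (cR n ρ) j z / (gradSq n ρ z : ℂ), fun _ _ => 0⟩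

/-- The (1,0) field N = (Σ|∂ρ/∂z_j|²)^{-1/2} Σ_j (∂ρ/∂z̄_j) ∂/∂z_j. -/
def NVF (n : ℕ) (ρ : Pt n → ℝ) : VF n :=
  ⟨fun z j => dZb n (cR n ρ) j z / ((Real.sqrt (gradSq n ρ z) : ℝ) : ℂ), fun _ _ => 0⟩

/-- T = L_n − conj(L_n). -/
def TVF (n : ℕ) (ρ : Pt n → ℝ) : VF n :=
  ⟨fun z j => (LnVF n ρ).a z j, fun z j => -(starRingEnd ℂ) ((LnVF n ρ).a z j)⟩

/-- η = (1/2)(∂ρ − ∂̄ρ). -/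
def etaF (n : ℕ) (ρ : Pt n → ℝ) : Form1 n :=
  ⟨fun z j => (1 / 2 : ℂ) * dZ n (cR n ρ) j z,
   fun z j => -(1 / 2 : ℂ) * dZb n (cR n ρ) j z⟩

/-- The D'Angelo 1-form α_ρ = −Lie_T η of a defining function ρ. -/
def dAngelo (n : ℕ) (ρ : Pt n → ℝ) : Form1 n := Form1.neg (lieD (TVF n ρ) (etaF n ρ))

/-- Evaluation of the (1,0)-part ∂η of the exterior derivative of a 1-form on two
complex tangent vectors. -/
def delEval {n : ℕ} (η : Form1 n) (X Y : (Fin n → ℂ) × (Fin n → ℂ)) (z : Pt n) : ℂ :=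
  (∑ m, ∑ l, dZ n (fun w => η.w w l) m z * (X.1 m * Y.1 l - Y.1 m * X.1 l)) +
  (∑ m, ∑ l, dZ n (fun w => η.t w l) m z * (X.1 m * Y.2 l - Y.1 m * X.2 l))

/-- Evaluation of ∂̄η of a 1-form η on two complex tangent vectors. -/
def delbEval {n : ℕ} (η : Form1 n) (X Y : (Fin n → ℂ) × (Fin n → ℂ)) (z : Pt n) : ℂ :=
  (∑ m, ∑ l, dZb n (fun w => η.w w l) m z * (X.2 m * Y.1 l - Y.2 m * X.1 l)) +
  (∑ m, ∑ l, dZb n (fun w => η.t w l) m z * (X.2 m * Y.2 l - Y.2 m * X.2 l))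

/-- Evaluation of dη = ∂η + ∂̄η. -/
def dEval {n : ℕ} (η : Form1 n) (X Y : (Fin n → ℂ) × (Fin n → ℂ)) (z : Pt n) : ℂ :=
  delEval η X Y z + delbEval η X Y z

/-- Evaluation of d^c η = i(∂̄ − ∂)η. -/
def dcEval {n : ℕ} (η : Form1 n) (X Y : (Fin n → ℂ) × (Fin n → ℂ)) (z : Pt n) : ℂ :=
  Complex.I * (delbEval η X Y z - delEval η X Y z)

/-- Evaluation of ω ∧ ω̄ on two complex tangent vectors, where ω = π_{1,0} η is the
(1,0)-component of the real 1-form η. -/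
def omegaWedge {n : ℕ} (η : Form1 n) (X Y : (Fin n → ℂ) × (Fin n → ℂ)) (z : Pt n) : ℂ :=
  (∑ j, η.w z j * X.1 j) * (∑ j, (starRingEnd ℂ) (η.w z j) * Y.2 j) -
  (∑ j, η.w z j * Y.1 j) * (∑ j, (starRingEnd ℂ) (η.w z j) * X.2 j)

/-- Evaluation of ∂̄ω where ω = π_{1,0} η. -/
def delbOmega {n : ℕ} (η : Form1 n) (X Y : (Fin n → ℂ) × (Fin n → ℂ)) (z : Pt n) : ℂ :=
  delbEval ⟨η.w, fun _ _ => 0⟩ X Y z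

/-- The standard Euclidean complex Hermitian metric g on complexified tangent vectors
(so that g(∂/∂z_j, ∂/∂z_j) = 1/2). -/
def gMet {n : ℕ} (X Y : (Fin n → ℂ) × (Fin n → ℂ)) : ℂ :=
  (1 / 2 : ℂ) * (∑ j, X.1 j * (starRingEnd ℂ) (Y.1 j) + ∑ j, X.2 j * (starRingEnd ℂ) (Y.2 j))

/-- The real gradient ∇ρ as a complex vector field: 2Σ_j (∂ρ/∂z̄_j ∂/∂z_j + ∂ρ/∂z_j ∂/∂z̄_j). -/
def gradVF (n : ℕ) (ρ : Pt n → ℝ) : VF n :=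
  ⟨fun z j => 2 * dZb n (cR n ρ) j z, fun z j => 2 * dZ n (cR n ρ) j z⟩

/-- Pseudoconvexity of Ω (w.r.t. the defining function ρ): the Levi form is positive
semidefinite on the holomorphic tangent spaces of the boundary. -/
def LeviPseudoconvex (n : ℕ) (ρ : Pt n → ℝ) (Ω : Set (Pt n)) : Prop :=
  ∀ p ∈ frontier Ω, ∀ X ∈ T10 n ρ p, 0 ≤ (levi n ρ p X X).re

/-- The set Σ of weakly pseudoconvex boundary points. -/
def weakPts (n : ℕ) (ρ : Pt n → ℝ) (Ω : Set (Pt n)) : Set (Pt n) :=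
  {p | p ∈ frontier Ω ∧ ∃ X ∈ T10 n ρ p, X ≠ 0 ∧ levi n ρ p X X = 0}

/-- Action of a complex tangent vector at p on a function. -/
def vecApp (n : ℕ) (X : (Fin n → ℂ) × (Fin n → ℂ)) (f : Pt n → ℂ) (p : Pt n) : ℂ :=
  ∑ j, X.1 j * dZ n f j p + ∑ j, X.2 j * dZb n f j p

/-- Pushforward (complexified differential) of a complex tangent vector at p by a map f. -/
def push (n : ℕ) (f : Pt n → Pt n) (p : Pt n) (X : (Fin n → ℂ) × (Fin n → ℂ)) :
    (Fin n → ℂ) × (Fin n → ℂ) :=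
  (fun l => vecApp n X (fun w => f w l) p,
   fun l => vecApp n X (fun w => (starRingEnd ℂ) (f w l)) p)

/-- Conjugation of a coefficient tuple. -/
def conjVec {n : ℕ} (X : Fin n → ℂ) : Fin n → ℂ := fun j => (starRingEnd ℂ) (X j)

/-- A C^k CR-diffeomorphism between ∂Ω₁ and ∂Ω₂, presented by a C^k map f on a
neighborhood U₁ of ∂Ω₁ together with a C^k local inverse g: f maps ∂Ω₁ onto ∂Ω₂
diffeomorphically and its differential maps T^{1,0}(∂Ω₁) into T^{1,0}(∂Ω₂). -/
def IsCRDiffeo (n : ℕ) (k : ℕ∞) (Ω₁ Ω₂ : Set (Pt n)) (ρ₁ ρ₂ : Pt n → ℝ)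
    (f g : Pt n → Pt n) (U₁ U₂ : Set (Pt n)) : Prop :=
  IsOpen U₁ ∧ IsOpen U₂ ∧ frontier Ω₁ ⊆ U₁ ∧ frontier Ω₂ ⊆ U₂ ∧
  (∀ l, ContDiffOn ℝ k (fun z => f z l) U₁) ∧
  (∀ l, ContDiffOn ℝ k (fun z => g z l) U₂) ∧
  f '' frontier Ω₁ = frontier Ω₂ ∧
  (∀ p ∈ frontier Ω₁, g (f p) = p) ∧ (∀ q ∈ frontier Ω₂, f (g q) = q) ∧
  (∀ p ∈ frontier Ω₁, ∀ L ∈ T10 n ρ₁ p,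
    (push n f p (L, 0)).2 = 0 ∧ (push n f p (L, 0)).1 ∈ T10 n ρ₂ (f p))

/-- The 1-form d^c ψ = i(∂̄ψ − ∂ψ) of a real function ψ. -/
def dcForm (n : ℕ) (ψ : Pt n → ℝ) : Form1 n :=
  ⟨fun z j => -Complex.I * dZ n (cR n ψ) j z, fun z j => Complex.I * dZb n (cR n ψ) j z⟩

end

section RealAnalysis

open Filter Topology
open scoped Manifold ContDiff

variable {E : Type*} [NormedAddCommGroup E] [NormedSpace ℝ E]

/-- Straightening a hypersurface `{f = 0}` along a transversal vector field `v`: the parameter `r`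
with `f (z - r z • v z) = 0` is as smooth as `f` and `v`, although its derivative along the
hypersurface, `(df v)⁻¹ df`, is a priori less smooth. -/
theorem exists_contDiffAt_transversal_parameter [CompleteSpace E] {m : ℕ∞ω} (hm0 : m ≠ 0)
    (hm : m ≠ ∞)
    {f : E → ℝ} {v : E → E} {p : E} (hf : ContDiffAt ℝ m f p) (hv : ContDiffAt ℝ m v p)
    (hfp : f p = 0) (hpos : 0 < fderiv ℝ f p (v p)) :
    ∃ r : E → ℝ, ∀ᶠ z in 𝓝 p, ContDiffAt ℝ m r z ∧ (f z < 0 → r z < 0) ∧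
      (f z = 0 → r z = 0 ∧ HasFDerivAt r ((fderiv ℝ f z (v z))⁻¹ • fderiv ℝ f z) z) ∧
      (0 < f z → 0 < r z) := by
  have hinner : ContDiffAt ℝ m (fun u : E × ℝ => u.1 - u.2 • v u.1) (p, 0) := by
    have : ContDiffAt ℝ m (fun u : E × ℝ => v u.1) (p, 0) :=
      ContDiffAt.comp (p, (0 : ℝ)) hv contDiffAt_fst
    exact contDiffAt_fst.sub (contDiffAt_snd.smul this)
  have hF : ContDiffAt ℝ m (fun u : E × ℝ => f (u.1 - u.2 • v u.1)) (p, 0) := by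
    refine ContDiffAt.comp (p, (0 : ℝ)) (g := f) ?_ hinner
    simpa using hf
  set F : E × ℝ → ℝ := fun u => f (u.1 - u.2 • v u.1) with hFdef
  have hone : fderiv ℝ F (p, 0) (0, 1) = -fderiv ℝ f p (v p) := by
    have h1 : HasDerivAt (fun t : ℝ => ((p, t) : E × ℝ)) (0, 1) 0 :=
      (hasDerivAt_const _ _).prodMk (hasDerivAt_id _)
    have h2 := (hF.differentiableAt hm0).hasFDerivAt.comp_hasDerivAt (0 : ℝ) h1
    have h3 : HasDerivAt (fun t : ℝ => p - t • v p) (-v p) 0 := by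
      simpa using ((hasDerivAt_id (0 : ℝ)).smul_const (v p)).const_sub p
    have hfd : HasFDerivAt f (fderiv ℝ f p) (p - (0 : ℝ) • v p) := by
      simpa using (hf.differentiableAt hm0).hasFDerivAt
    have h4 := hfd.comp_hasDerivAt (0 : ℝ) h3
    have := h2.unique h4
    simpa using this
  have hinv : (fderiv ℝ F (p, 0) ∘L .inr ℝ E ℝ).IsInvertible := by
    have hne : fderiv ℝ F (p, 0) (0, 1) ≠ 0 := by rw [hone]; exact neg_ne_zero.2 hpos.ne'
    refine ⟨ContinuousLinearEquiv.unitsEquivAut ℝ (Units.mk0 _ hne), ?_⟩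
    ext
    simp
  set r := hF.implicitFunction hm0 hinv with hr
  have hrp : r p = 0 := hF.implicitFunction_apply_self hm0 hinv
  have hrs : ContDiffAt ℝ m r p := hF.contDiffAt_implicitFunction hm0 hinv
  have hzero : ∀ᶠ z in 𝓝 p, f (z - r z • v z) = 0 := by
    have := hF.eventually_apply_implicitFunction hm0 hinv
    simpa [F, hfp] using this
  have hback : Tendsto (fun z => z - r z • v z) (𝓝 p) (𝓝 p) := by
    have : ContinuousAt (fun z => z - r z • v z) p :=
      continuousAt_id.sub (hrs.continuousAt.smul hv.continuousAt)
    simpa [ContinuousAt, hrp] using this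
  set ε := fderiv ℝ f p (v p) / (2 * (‖v p‖ + 1)) with hε
  have hεpos : 0 < ε := by positivity
  have hest : ∀ᶠ z in 𝓝 p, |f z - r z * fderiv ℝ f p (v z)| ≤ ε * (|r z| * ‖v z‖) := by
    have h1 := (hf.hasStrictFDerivAt hm0).isLittleO.def hεpos
    have h2 : Tendsto (fun z => (z, z - r z • v z)) (𝓝 p) (𝓝 (p, p)) := by
      rw [nhds_prod_eq]; exact tendsto_id.prodMk hback
    filter_upwards [h2.eventually h1, hzero] with z hz hz0
    simpa [hz0, norm_smul] using hz
  have hlt : ∀ᶠ z in 𝓝 p, ε * ‖v z‖ < fderiv ℝ f p (v z) := by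
    have hc1 : ContinuousAt (fun z => ε * ‖v z‖) p := continuousAt_const.mul hv.continuousAt.norm
    have hc2 : ContinuousAt (fun z => fderiv ℝ f p (v z)) p :=
      (fderiv ℝ f p).continuous.continuousAt.comp hv.continuousAt
    refine hc1.eventually_lt hc2 ?_
    rw [hε, div_mul_eq_mul_div, div_lt_iff₀ (by positivity)]
    nlinarith [norm_nonneg (v p)]
  have hsign : ∀ᶠ z in 𝓝 p, (f z < 0 → r z < 0) ∧ (f z = 0 → r z = 0) ∧ (0 < f z → 0 < r z) := by
    filter_upwards [hest, hlt] with z h1 h2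
    have h3 := abs_le.1 h1
    have hp : 0 < r z → 0 < f z := fun h => by
      rw [abs_of_pos h] at h3; nlinarith
    have hn : r z < 0 → f z < 0 := fun h => by
      rw [abs_of_neg h] at h3; nlinarith
    have h0 : r z = 0 → f z = 0 := fun h => by
      simpa [h] using h1
    rcases lt_trichotomy (r z) 0 with h | h | h
    · have := hn h
      exact ⟨fun _ => h, fun h' => by linarith, fun h' => by linarith⟩
    · have := h0 h
      exact ⟨fun h' => by linarith, fun _ => h, fun h' => by linarith⟩
    · have := hp h
      exact ⟨fun h' => by linarith, fun h' => by linarith, fun _ => h⟩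
  have hpos' : ∀ᶠ z in 𝓝 p, 0 < fderiv ℝ f z (v z) := by
    have hc : ContinuousAt (fun z => fderiv ℝ f z (v z)) p :=
      (hf.continuousAt_fderiv hm0).clm_apply hv.continuousAt
    exact hc.eventually (lt_mem_nhds hpos)
  refine ⟨r, ?_⟩
  filter_upwards [hrs.eventually hm, hsign, hzero.eventually_nhds, hpos', hf.eventually hm,
    hv.eventually hm] with z hz hs h0 hz' hfz hvz
  refine ⟨hz, hs.1, fun h => ⟨hs.2.1 h, ?_⟩, hs.2.2⟩
  have hrz := hs.2.1 h
  have hrd := (hz.differentiableAt hm0).hasFDerivAt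
  have hinn := (hasFDerivAt_id (𝕜 := ℝ) z).sub
    (hrd.smul (hvz.differentiableAt hm0).hasFDerivAt)
  have hfd : HasFDerivAt f (fderiv ℝ f z) (z - r z • v z) := by
    simpa [hrz] using (hfz.differentiableAt hm0).hasFDerivAt
  have hcomp := hfd.comp z hinn
  have hconst : HasFDerivAt (f ∘ fun w => w - r w • v w) (0 : E →L[ℝ] ℝ) z :=
    (hasFDerivAt_const (0 : ℝ) z).congr_of_eventuallyEq h0
  have heq := hcomp.unique hconst
  refine hrd.congr_fderiv (ContinuousLinearMap.ext fun u => ?_)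
  have := congrArg (fun A : E →L[ℝ] ℝ => A u) heq
  simp [hrz] at this
  change _ = (fderiv ℝ f z (v z))⁻¹ * fderiv ℝ f z u
  field_simp
  linarith

/-- Local defining functions with prescribed derivative along the boundary can be glued. -/
theorem exists_contDiff_of_local_defining [FiniteDimensional ℝ E] {m : ℕ∞} {Ω : Set E}
    (L : E → E →L[ℝ] ℝ)
    (hloc : ∀ p, ∃ r : E → ℝ, ∀ᶠ z in 𝓝 p, ContDiffAt ℝ m r z ∧ (z ∈ Ω → r z < 0) ∧
      (z ∈ frontier Ω → r z = 0 ∧ HasFDerivAt r (L z) z) ∧ (z ∉ closure Ω → 0 < r z)) :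
    ∃ r : E → ℝ, ∀ z, ContDiffAt ℝ m r z ∧ (z ∈ Ω → r z < 0) ∧
      (z ∈ frontier Ω → r z = 0 ∧ HasFDerivAt r (L z) z) ∧ (z ∉ closure Ω → 0 < r z) := by
  choose r hr using hloc
  choose W hW hWo hWp using fun p => eventually_nhds_iff.1 (hr p)
  obtain ⟨χ, hχ⟩ := SmoothPartitionOfUnity.exists_isSubordinate 𝓘(ℝ, E) (isClosed_univ (X := E)) W
    hWo (fun p _ => Set.mem_iUnion.2 ⟨p, hWp p⟩)
  have hmem : ∀ z i, χ i z ≠ 0 → z ∈ W i := fun z i h => hχ i (subset_tsupport _ h)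
  have hconv : ∀ z (t : Set ℝ), Convex ℝ t → (∀ i, z ∈ W i → r i z ∈ t) →
      ∑ᶠ i, χ i z • r i z ∈ t := fun z t ht h =>
    χ.finsum_smul_mem_convex (Set.mem_univ z) (fun i hi => h i (hmem z i hi)) ht
  refine ⟨fun z => ∑ᶠ i, χ i z • r i z, fun z => ⟨?_, fun hz => ?_, fun hz => ⟨?_, ?_⟩,
    fun hz => ?_⟩⟩
  · exact χ.contDiffAt_finsum fun i hi => (hW i z (hχ i hi)).1
  · exact hconv z (Set.Iio 0) (convex_Iio 0) fun i hi => (hW i z hi).2.1 hz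
  · exact hconv z {0} (convex_singleton 0) fun i hi => ((hW i z hi).2.2.1 hz).1
  · have hev : (fun w => ∑ᶠ i, χ i w • r i w) =ᶠ[𝓝 z]
        fun w => ∑ i ∈ χ.fintsupport z, χ i w • r i w := by
      filter_upwards [χ.eventually_finsupport_subset z] with w hw
      refine finsum_eq_sum_of_support_subset _ fun i hi => hw ?_
      rw [SmoothPartitionOfUnity.mem_finsupport]
      exact fun h => hi (by simp [h])
    refine HasFDerivAt.congr_of_eventuallyEq ?_ hev
    have hsum : HasFDerivAt (fun w => ∑ i ∈ χ.fintsupport z, χ i w • r i w)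
        (∑ i ∈ χ.fintsupport z, χ i z • L z) z := by
      refine HasFDerivAt.fun_sum fun i hi => ?_
      obtain ⟨h0, hd⟩ := (hW i z (hχ i ((χ.mem_fintsupport_iff z i).1 hi))).2.2.1 hz
      have hχd : DifferentiableAt ℝ (χ i) z :=
        ((χ i).contMDiff.contDiff.differentiable (by simp)).differentiableAt
      simpa [h0] using hχd.hasFDerivAt.fun_smul hd
    rwa [← Finset.sum_smul, χ.sum_finsupport' z (Set.mem_univ z) (χ.finsupport_subset_fintsupport z),
      one_smul] at hsum
  · exact hconv z (Set.Ioi 0) (convex_Ioi 0) fun i hi => (hW i z hi).2.2.2 hz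

/-- A function vanishing on a regular hypersurface `{g = 0}` has derivative proportional to `dg`. -/
theorem exists_fderiv_eq_smul_of_eq_zero_on [CompleteSpace E] {g φ : E → ℝ} {p : E}
    (hg : ContDiffAt ℝ 1 g p) (hgp : g p = 0) (hg' : fderiv ℝ g p ≠ 0)
    (hφ : ContDiffAt ℝ 1 φ p) (h : ∀ᶠ z in 𝓝 p, g z = 0 → φ z = 0) :
    ∃ c : ℝ, fderiv ℝ φ p = c • fderiv ℝ g p := by
  have hφp := h.self_of_nhds hgp
  have hext : IsLocalExtrOn φ {x | g x = g p} p := by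
    left
    have : ∀ᶠ z in 𝓝[{x | g x = g p}] p, φ p ≤ φ z := by
      rw [eventually_nhdsWithin_iff]
      filter_upwards [h] with z hz hzg
      rw [hφp, hz (by simpa [hgp] using hzg)]
    exact this
  obtain ⟨a, b, hab, heq⟩ := hext.exists_multipliers_of_hasStrictFDerivAt_1d
    (hg.hasStrictFDerivAt one_ne_zero) (hφ.hasStrictFDerivAt one_ne_zero)
  have hb : b ≠ 0 := by
    rintro rfl
    have ha : a ≠ 0 := by rintro rfl; exact hab rfl
    simp [ha, hg'] at heq
  refine ⟨-(b⁻¹ * a), ?_⟩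
  rw [neg_smul, mul_smul, ← smul_neg, eq_inv_smul_iff₀ hb, eq_neg_iff_add_eq_zero, add_comm]
  exact heq

end RealAnalysis

section WirtingerCalculus

open Filter Topology

variable {n : ℕ} {f g : Pt n → ℂ} {p : Pt n} {X : (Fin n → ℂ) × (Fin n → ℂ)}

theorem fderiv_apply_eq_vecApp (f : Pt n → ℂ) (p u : Pt n) :
    fderiv ℝ f p u = vecApp n (u, conjVec u) f p := by
  have hu : u = ∑ j, ((u j).re • (Pi.single j (1 : ℂ) : Pt n) +
      (u j).im • (Pi.single j Complex.I : Pt n)) := by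
    ext i
    simp [Finset.sum_apply, Pi.single_apply, Finset.sum_add_distrib]
  conv_lhs => rw [hu]
  simp only [map_sum, map_add, map_smul, vecApp, conjVec, dZ, dZb, ← Finset.sum_add_distrib]
  refine Finset.sum_congr rfl fun j _ => ?_
  simp only [Complex.real_smul]
  have hre : u j = (u j).re + (u j).im * Complex.I := (Complex.re_add_im _).symm
  have him : (starRingEnd ℂ) (u j) = (u j).re - (u j).im * Complex.I := by
    apply Complex.ext <;> simp
  linear_combination ((u j).im : ℂ) * fderiv ℝ f p (Pi.single j Complex.I) * Complex.I_mul_I -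
    (1 / 2) * (fderiv ℝ f p (Pi.single j 1) - Complex.I * fderiv ℝ f p (Pi.single j Complex.I)) *
      hre -
    (1 / 2) * (fderiv ℝ f p (Pi.single j 1) + Complex.I * fderiv ℝ f p (Pi.single j Complex.I)) *
      him

theorem vecApp_add_smul (A B : (Fin n → ℂ) × (Fin n → ℂ)) (c : ℂ) (f : Pt n → ℂ) (p : Pt n) :
    vecApp n (A + c • B) f p = vecApp n A f p + c * vecApp n B f p := by
  simp only [vecApp, Prod.fst_add, Prod.snd_add, Prod.smul_fst, Prod.smul_snd, Pi.add_apply,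
    Pi.smul_apply, smul_eq_mul, add_mul, Finset.sum_add_distrib, mul_add, Finset.mul_sum, mul_assoc]
  ring

/-- Every complex tangent vector is `u + i u'` with `u`, `u'` real. -/
theorem exists_vecApp_eq_fderiv (X : (Fin n → ℂ) × (Fin n → ℂ)) :
    ∃ u u' : Pt n, ∀ (f : Pt n → ℂ) (p : Pt n),
      vecApp n X f p = fderiv ℝ f p u + Complex.I * fderiv ℝ f p u' := by
  refine ⟨fun j => (X.1 j + (starRingEnd ℂ) (X.2 j)) / 2,
    fun j => -Complex.I * ((X.1 j - (starRingEnd ℂ) (X.2 j)) / 2), fun f p => ?_⟩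
  rw [fderiv_apply_eq_vecApp, fderiv_apply_eq_vecApp, ← vecApp_add_smul]
  congr 1
  ext j
  · simp only [Prod.fst_add, Prod.smul_fst, Pi.add_apply, Pi.smul_apply, smul_eq_mul]
    linear_combination -(X.1 j - (starRingEnd ℂ) (X.2 j)) / 2 * -Complex.I_mul_I
  · simp only [conjVec, Prod.snd_add, Prod.smul_snd, Pi.add_apply, Pi.smul_apply, smul_eq_mul,
      map_add, map_sub, map_mul, map_neg, map_div₀, Complex.conj_conj, Complex.conj_I, map_ofNat]
    linear_combination -((starRingEnd ℂ) (X.1 j) - X.2 j) / 2 * Complex.I_mul_I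

theorem vecApp_const (c : ℂ) : vecApp n X (fun _ => c) p = 0 := by
  obtain ⟨u, u', hX⟩ := exists_vecApp_eq_fderiv X
  simp [hX]

theorem vecApp_add (hf : DifferentiableAt ℝ f p) (hg : DifferentiableAt ℝ g p) :
    vecApp n X (fun z => f z + g z) p = vecApp n X f p + vecApp n X g p := by
  obtain ⟨u, u', hX⟩ := exists_vecApp_eq_fderiv X
  rw [hX, hX, hX, fderiv_fun_add hf hg]
  simp only [add_apply]
  ring

theorem vecApp_sub (hf : DifferentiableAt ℝ f p) (hg : DifferentiableAt ℝ g p) :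
    vecApp n X (fun z => f z - g z) p = vecApp n X f p - vecApp n X g p := by
  obtain ⟨u, u', hX⟩ := exists_vecApp_eq_fderiv X
  rw [hX, hX, hX, fderiv_fun_sub hf hg]
  simp only [sub_apply]
  ring

theorem vecApp_mul (hf : DifferentiableAt ℝ f p) (hg : DifferentiableAt ℝ g p) :
    vecApp n X (fun z => f z * g z) p = f p * vecApp n X g p + g p * vecApp n X f p := by
  obtain ⟨u, u', hX⟩ := exists_vecApp_eq_fderiv X
  rw [hX, hX, hX, fderiv_fun_mul hf hg]
  simp only [add_apply, smul_apply, smul_eq_mul]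
  ring

theorem vecApp_const_mul (c : ℂ) (hf : DifferentiableAt ℝ f p) :
    vecApp n X (fun z => c * f z) p = c * vecApp n X f p := by
  rw [vecApp_mul (differentiableAt_const c) hf, vecApp_const]
  ring

theorem vecApp_sum {ι : Type*} (s : Finset ι) {F : ι → Pt n → ℂ}
    (hF : ∀ i ∈ s, DifferentiableAt ℝ (F i) p) :
    vecApp n X (fun z => ∑ i ∈ s, F i z) p = ∑ i ∈ s, vecApp n X (F i) p := by
  obtain ⟨u, u', hX⟩ := exists_vecApp_eq_fderiv X
  simp only [hX, fderiv_fun_sum hF, sum_apply, Finset.sum_add_distrib, Finset.mul_sum]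

theorem contDiffAt_dZ (hf : ContDiffAt ℝ 2 f p) (j : Fin n) : ContDiffAt ℝ 1 (dZ n f j) p := by
  have h : ContDiffAt ℝ 1 (fderiv ℝ f) p := hf.fderiv_right (by norm_num)
  unfold dZ
  fun_prop

theorem contDiffAt_dZb (hf : ContDiffAt ℝ 2 f p) (j : Fin n) : ContDiffAt ℝ 1 (dZb n f j) p := by
  have h : ContDiffAt ℝ 1 (fderiv ℝ f) p := hf.fderiv_right (by norm_num)
  unfold dZb
  fun_prop

theorem vecApp_vecApp_eq_sum (hf : ContDiffAt ℝ 2 f p) (A B : (Fin n → ℂ) × (Fin n → ℂ)) :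
    vecApp n A (fun z => vecApp n B f z) p =
      ∑ l, B.1 l * vecApp n A (dZ n f l) p + ∑ l, B.2 l * vecApp n A (dZb n f l) p := by
  have h1 : ∀ l, DifferentiableAt ℝ (dZ n f l) p :=
    fun l => (contDiffAt_dZ hf l).differentiableAt one_ne_zero
  have h2 : ∀ l, DifferentiableAt ℝ (dZb n f l) p :=
    fun l => (contDiffAt_dZb hf l).differentiableAt one_ne_zero
  change vecApp n A (fun z => ∑ l, B.1 l * dZ n f l z + ∑ l, B.2 l * dZb n f l z) p = _
  rw [vecApp_add (by fun_prop) (by fun_prop), vecApp_sum _ (fun l _ => (h1 l).const_mul _),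
    vecApp_sum _ (fun l _ => (h2 l).const_mul _)]
  simp only [vecApp_const_mul _ (h1 _), vecApp_const_mul _ (h2 _)]

theorem vecApp_vecApp_comm (hf : ContDiffAt ℝ 2 f p) (A B : (Fin n → ℂ) × (Fin n → ℂ)) :
    vecApp n A (fun z => vecApp n B f z) p = vecApp n B (fun z => vecApp n A f z) p := by
  have hd : DifferentiableAt ℝ (fderiv ℝ f) p :=
    (hf.fderiv_right (m := 1) (by norm_num)).differentiableAt one_ne_zero
  have hsymm : IsSymmSndFDerivAt ℝ f p := hf.isSymmSndFDerivAt (by simp)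
  obtain ⟨a, a', hA⟩ := exists_vecApp_eq_fderiv A
  obtain ⟨b, b', hB⟩ := exists_vecApp_eq_fderiv B
  have key : ∀ u u' w : Pt n,
      fderiv ℝ (fun z => fderiv ℝ f z u + Complex.I * fderiv ℝ f z u') p w =
        fderiv ℝ (fderiv ℝ f) p w u + Complex.I * fderiv ℝ (fderiv ℝ f) p w u' := by
    intro u u' w
    have h := ((hd.hasFDerivAt.clm_apply (hasFDerivAt_const u p)).fun_add
      ((hd.hasFDerivAt.clm_apply (hasFDerivAt_const u' p)).const_mul Complex.I)).fderiv
    have h' := congrArg (fun A : Pt n →L[ℝ] ℂ => A w) h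
    simpa using h'
  simp only [hA, hB, key]
  rw [hsymm.eq a b, hsymm.eq a b', hsymm.eq a' b, hsymm.eq a' b']
  ring

end WirtingerCalculus

section BoundaryForms

open Filter Topology

variable {n : ℕ} {ρ : Pt n → ℝ} {p : Pt n} {X : (Fin n → ℂ) × (Fin n → ℂ)}

/-- Functions vanishing on `{ρ = 0}` are annihilated by complex tangent vectors. -/
theorem vecApp_eq_zero_of_tangent (hρ : ContDiffAt ℝ 1 ρ p) (hρp : ρ p = 0)
    (hρ' : fderiv ℝ ρ p ≠ 0) {f : Pt n → ℂ} (hf : ContDiffAt ℝ 1 f p)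
    (h : ∀ᶠ z in 𝓝 p, ρ z = 0 → f z = 0) (hX : vecApp n X (cR n ρ) p = 0) :
    vecApp n X f p = 0 := by
  obtain ⟨c, hc⟩ := exists_fderiv_eq_smul_of_eq_zero_on hρ hρp hρ'
    (φ := fun z => (f z).re) (Complex.reCLM.contDiff.contDiffAt.comp p hf)
    (h.mono fun z hz h0 => by simp [hz h0])
  obtain ⟨d, hd⟩ := exists_fderiv_eq_smul_of_eq_zero_on hρ hρp hρ'
    (φ := fun z => (f z).im) (Complex.imCLM.contDiff.contDiffAt.comp p hf)
    (h.mono fun z hz h0 => by simp [hz h0])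
  have hfd := (hf.differentiableAt one_ne_zero).hasFDerivAt
  have hre : HasFDerivAt (fun z => (f z).re) (Complex.reCLM.comp (fderiv ℝ f p)) p :=
    Complex.reCLM.hasFDerivAt.comp p hfd
  have him : HasFDerivAt (fun z => (f z).im) (Complex.imCLM.comp (fderiv ℝ f p)) p :=
    Complex.imCLM.hasFDerivAt.comp p hfd
  have hcR : HasFDerivAt (cR n ρ) (Complex.ofRealCLM.comp (fderiv ℝ ρ p)) p :=
    Complex.ofRealCLM.hasFDerivAt.comp p (hρ.differentiableAt one_ne_zero).hasFDerivAt
  rw [hre.fderiv] at hc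
  rw [him.fderiv] at hd
  have hprop : ∀ u, fderiv ℝ f p u = (c + d * Complex.I) * fderiv ℝ (cR n ρ) p u := by
    intro u
    have h1 := congrArg (fun A : Pt n →L[ℝ] ℝ => A u) hc
    have h2 := congrArg (fun A : Pt n →L[ℝ] ℝ => A u) hd
    simp only [ContinuousLinearMap.comp_apply, Complex.reCLM_apply, Complex.imCLM_apply,
      smul_apply, smul_eq_mul] at h1 h2
    rw [hcR.fderiv]
    apply Complex.ext <;> simp [h1, h2]
  obtain ⟨u, u', hXu⟩ := exists_vecApp_eq_fderiv X
  rw [hXu] at hX ⊢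
  rw [hprop, hprop]
  linear_combination (c + d * Complex.I) * hX

theorem eval_lieD (T : VF n) (η : Form1 n) (p : Pt n) (X : (Fin n → ℂ) × (Fin n → ℂ)) :
    Form1.eval (lieD T η) p X =
      ∑ l, X.1 l * vecApp n (T.atPt p) (fun z => η.w z l) p +
      ∑ l, X.2 l * vecApp n (T.atPt p) (fun z => η.t z l) p +
      ∑ m, η.w p m * vecApp n X (fun z => T.a z m) p +
      ∑ m, η.t p m * vecApp n X (fun z => T.b z m) p := by
  simp only [Form1.eval, lieD, VF.app, vecApp, VF.atPt, add_mul, mul_add, Finset.sum_add_distrib,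
    Finset.mul_sum, Finset.sum_mul]
  rw [Finset.sum_comm (f := fun i j => η.w p j * dZ n (fun w => T.a w j) i p * X.1 i),
    Finset.sum_comm (f := fun i j => η.t p j * dZ n (fun w => T.b w j) i p * X.1 i),
    Finset.sum_comm (f := fun i j => η.w p j * dZb n (fun w => T.a w j) i p * X.2 i),
    Finset.sum_comm (f := fun i j => η.t p j * dZb n (fun w => T.b w j) i p * X.2 i)]
  simp only [mul_comm, mul_left_comm]
  ring

theorem sum_sum_mul_sub_eq (D : Fin n → Fin n → ℂ) (x x' y y' : Fin n → ℂ) :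
    ∑ m, ∑ l, D m l * (x m * y l - y' m * x' l) =
      ∑ l, y l * ∑ m, x m * D m l - ∑ l, x' l * ∑ m, y' m * D m l := by
  rw [Finset.sum_comm, ← Finset.sum_sub_distrib]
  refine Finset.sum_congr rfl fun l _ => ?_
  rw [Finset.mul_sum, Finset.mul_sum, ← Finset.sum_sub_distrib]
  exact Finset.sum_congr rfl fun m _ => by ring

theorem dEval_eq_sum (η : Form1 n) (A B : (Fin n → ℂ) × (Fin n → ℂ)) (p : Pt n) :
    dEval η A B p =
      (∑ l, B.1 l * vecApp n A (fun z => η.w z l) p + ∑ l, B.2 l * vecApp n A (fun z => η.t z l) p) -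
      (∑ l, A.1 l * vecApp n B (fun z => η.w z l) p +
        ∑ l, A.2 l * vecApp n B (fun z => η.t z l) p) := by
  simp only [dEval, delEval, delbEval, sum_sum_mul_sub_eq, vecApp, mul_add, Finset.sum_add_distrib]
  ring

/-- Cartan's formula on the hypersurface `{ρ = 0}` for a pair with `η(T) = 1` there. -/
theorem eval_lieD_eq_dEval (hρ : ContDiffAt ℝ 1 ρ p) (hρp : ρ p = 0) (hρ' : fderiv ℝ ρ p ≠ 0)
    {T : VF n} {η : Form1 n}
    (hw : ∀ j, ContDiffAt ℝ 1 (fun z => η.w z j) p) (ht : ∀ j, ContDiffAt ℝ 1 (fun z => η.t z j) p)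
    (ha : ∀ j, ContDiffAt ℝ 1 (fun z => T.a z j) p) (hb : ∀ j, ContDiffAt ℝ 1 (fun z => T.b z j) p)
    (h : ∀ᶠ z in 𝓝 p, ρ z = 0 → Form1.app η T z = 1) (hX : vecApp n X (cR n ρ) p = 0) :
    Form1.eval (lieD T η) p X = dEval η (T.atPt p) X p := by
  have hw' := fun j => (hw j).differentiableAt one_ne_zero
  have ht' := fun j => (ht j).differentiableAt one_ne_zero
  have ha' := fun j => (ha j).differentiableAt one_ne_zero
  have hb' := fun j => (hb j).differentiableAt one_ne_zero
  have h0 : vecApp n X (fun z => (∑ j, η.w z j * T.a z j + ∑ j, η.t z j * T.b z j) - 1) p = 0 := by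
    refine vecApp_eq_zero_of_tangent hρ hρp hρ' (by fun_prop) ?_ hX
    filter_upwards [h] with z hz hz0
    exact sub_eq_zero.2 (hz hz0)
  rw [vecApp_sub (by fun_prop) (by fun_prop), vecApp_const, vecApp_add (by fun_prop) (by fun_prop),
    vecApp_sum _ (fun j _ => (hw' j).fun_mul (ha' j)),
    vecApp_sum _ (fun j _ => (ht' j).fun_mul (hb' j))] at h0
  simp only [fun j => vecApp_mul (X := X) (hw' j) (ha' j),
    fun j => vecApp_mul (X := X) (ht' j) (hb' j), Finset.sum_add_distrib] at h0
  rw [eval_lieD, dEval_eq_sum]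
  simp only [VF.atPt] at *
  linear_combination h0

/-- Adding a multiple of `dρ` to a 1-form does not change its exterior derivative on vectors
tangent to `{ρ = 0}`. -/
theorem dEval_eq_of_eq_add_mul (hρ : ContDiffAt ℝ 2 ρ p) (hρp : ρ p = 0) (hρ' : fderiv ℝ ρ p ≠ 0)
    {η η' : Form1 n} {g : Pt n → ℂ} (c : ℂ)
    (hw : ∀ j, ContDiffAt ℝ 1 (fun z => η.w z j) p) (ht : ∀ j, ContDiffAt ℝ 1 (fun z => η.t z j) p)
    (hw' : ∀ j, ContDiffAt ℝ 1 (fun z => η'.w z j) p)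
    (ht' : ∀ j, ContDiffAt ℝ 1 (fun z => η'.t z j) p) (hg : ContDiffAt ℝ 1 g p)
    (h : ∀ᶠ z in 𝓝 p, ρ z = 0 → ∀ j, η.w z j = c * η'.w z j + g z * dZ n (cR n ρ) j z ∧
      η.t z j = c * η'.t z j + g z * dZb n (cR n ρ) j z)
    {A B : (Fin n → ℂ) × (Fin n → ℂ)} (hA : vecApp n A (cR n ρ) p = 0)
    (hB : vecApp n B (cR n ρ) p = 0) : dEval η A B p = c * dEval η' A B p := by
  have hcR : ContDiffAt ℝ 2 (cR n ρ) p := Complex.ofRealCLM.contDiff.contDiffAt.comp p hρ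
  have hd {f : Pt n → ℂ} (hf : ContDiffAt ℝ 1 f p) : DifferentiableAt ℝ f p :=
    hf.differentiableAt one_ne_zero
  have key : ∀ (f f' r : Pt n → ℂ), ContDiffAt ℝ 1 f p → ContDiffAt ℝ 1 f' p →
      ContDiffAt ℝ 1 r p → (∀ᶠ z in 𝓝 p, ρ z = 0 → f z = c * f' z + g z * r z) →
      ∀ X : (Fin n → ℂ) × (Fin n → ℂ), vecApp n X (cR n ρ) p = 0 →
      vecApp n X f p = c * vecApp n X f' p + (g p * vecApp n X r p + r p * vecApp n X g p) := by
    intro f f' r hf hf' hr hfr X hX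
    have h0 : vecApp n X (fun z => f z - (c * f' z + g z * r z)) p = 0 := by
      refine vecApp_eq_zero_of_tangent (hρ.of_le (by norm_num)) hρp hρ' (by fun_prop) ?_ hX
      filter_upwards [hfr] with z hz hz0
      exact sub_eq_zero.2 (hz hz0)
    rw [vecApp_sub (hd hf) (((hd hf').const_mul c).fun_add ((hd hg).fun_mul (hd hr))),
      vecApp_add ((hd hf').const_mul c) ((hd hg).fun_mul (hd hr)), vecApp_const_mul c (hd hf'),
      vecApp_mul (hd hg) (hd hr)] at h0
    exact sub_eq_zero.1 h0
  have kw := fun j X hX => key _ _ _ (hw j) (hw' j) (contDiffAt_dZ hcR j)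
    (h.mono fun z hz h0 => (hz h0 j).1) X hX
  have kt := fun j X hX => key _ _ _ (ht j) (ht' j) (contDiffAt_dZb hcR j)
    (h.mono fun z hz h0 => (hz h0 j).2) X hX
  have hsymm := vecApp_vecApp_comm hcR A B
  rw [vecApp_vecApp_eq_sum hcR, vecApp_vecApp_eq_sum hcR] at hsymm
  rw [dEval_eq_sum, dEval_eq_sum]
  simp only [kw _ A hA, kw _ B hB, kt _ A hA, kt _ B hB]
  have expand : ∀ (x F R r : Fin n → ℂ) (e : ℂ),
      ∑ l, x l * (c * F l + (g p * R l + r l * e)) =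
        c * ∑ l, x l * F l + g p * ∑ l, x l * R l + e * ∑ l, x l * r l := by
    intro x F R r e
    simp only [Finset.mul_sum, ← Finset.sum_add_distrib]
    exact Finset.sum_congr rfl fun l _ => by ring
  simp only [expand]
  unfold vecApp at hA hB
  linear_combination g p * hsymm + vecApp n A g p * hB - vecApp n B g p * hA

end BoundaryForms

section Frame

variable {n : ℕ}

theorem eq_mul_of_annihilates {R w : Fin n → ℂ} (hR : ∑ l, Complex.normSq (R l) ≠ 0)
    (h : ∀ X : Fin n → ℂ, ∑ j, X j * R j = 0 → ∑ j, w j * X j = 0) (j : Fin n) :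
    w j = (∑ l, w l * (starRingEnd ℂ) (R l)) / (∑ l, Complex.normSq (R l) : ℝ) * R j := by
  have hswap : ∀ l, w j * R l = w l * R j := by
    intro l
    have := h (R l • Pi.single j 1 - R j • Pi.single l 1) (by
      simp only [Pi.sub_apply, Pi.smul_apply, smul_eq_mul, sub_mul, Finset.sum_sub_distrib,
        Pi.single_apply, mul_ite, mul_one, mul_zero, ite_mul, zero_mul, Finset.sum_ite_eq',
        Finset.mem_univ, if_true]
      ring)
    simp only [Pi.sub_apply, Pi.smul_apply, smul_eq_mul, mul_sub, Finset.sum_sub_distrib,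
      Pi.single_apply, mul_ite, mul_one, mul_zero, Finset.sum_ite_eq', Finset.mem_univ,
      if_true] at this
    exact sub_eq_zero.1 this
  have hG : ((∑ l, Complex.normSq (R l) : ℝ) : ℂ) ≠ 0 := Complex.ofReal_ne_zero.2 hR
  rw [div_mul_eq_mul_div, eq_div_iff hG, Complex.ofReal_sum, Finset.mul_sum, Finset.sum_mul]
  refine Finset.sum_congr rfl fun l _ => ?_
  rw [← Complex.mul_conj]
  linear_combination (starRingEnd ℂ) (R l) * hswap l

/-- Normal form of a pair `(η, T)` at a boundary point, where `R` is the coefficient vector of `∂ρ`: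
`T` is a real multiple of `L_n - L̄_n`, and `η` is `c ∂ρ - c̄ ∂̄ρ`. -/
theorem normal_form_of_annihilates {R w t a b : Fin n → ℂ}
    (hR : ∑ l, Complex.normSq (R l) ≠ 0)
    (ht : ∀ j, (starRingEnd ℂ) (t j) = -w j) (hb : ∀ j, (starRingEnd ℂ) (b j) = -a j)
    (hw : ∀ X : Fin n → ℂ, ∑ j, X j * R j = 0 → ∑ j, w j * X j = 0)
    (ha : ∀ X : Fin n → ℂ, ∑ j, X j * R j = 0 → ∑ j, a j * (starRingEnd ℂ) (X j) = 0)
    (htan : ∑ j, a j * R j + ∑ j, b j * (starRingEnd ℂ) (R j) = 0)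
    (hone : ∑ j, w j * a j + ∑ j, t j * b j = 1) :
    ∃ D : ℝ, ∑ j, a j * R j = D ∧ D ≠ 0 ∧
      (∀ j, a j = D * (starRingEnd ℂ) (R j) / (∑ l, Complex.normSq (R l) : ℝ)) ∧
      (∀ j, b j = -(D * R j / (∑ l, Complex.normSq (R l) : ℝ))) ∧
      ∃ c : ℂ, c = (∑ l, w l * (starRingEnd ℂ) (R l)) / (∑ l, Complex.normSq (R l) : ℝ) ∧
        (∀ j, w j = c * R j) ∧ (∀ j, t j = -((starRingEnd ℂ) c * (starRingEnd ℂ) (R j))) ∧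
        (c + (starRingEnd ℂ) c) * D = 1 := by
  have ht' : ∀ j, t j = -(starRingEnd ℂ) (w j) := fun j => by
    rw [← Complex.conj_conj (t j), ht, map_neg]
  have hb' : ∀ j, b j = -(starRingEnd ℂ) (a j) := fun j => by
    rw [← Complex.conj_conj (b j), hb, map_neg]
  set S := ∑ j, a j * R j with hS
  have hconjS : (starRingEnd ℂ) S = ∑ j, (starRingEnd ℂ) (a j) * (starRingEnd ℂ) (R j) := by
    simp [hS]
  have hreal : (starRingEnd ℂ) S = S := by
    have : ∑ j, b j * (starRingEnd ℂ) (R j) = -(starRingEnd ℂ) S := by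
      simp [hconjS, hb']
    rw [this] at htan
    linear_combination -htan
  obtain ⟨D, hD⟩ := Complex.conj_eq_iff_real.1 hreal
  have haj : ∀ j, a j = D * (starRingEnd ℂ) (R j) / (∑ l, Complex.normSq (R l) : ℝ) := by
    intro j
    have := eq_mul_of_annihilates (w := fun j => (starRingEnd ℂ) (a j)) hR (fun X hX => by
      simpa using congrArg (starRingEnd ℂ) (ha X hX)) j
    rw [← hconjS, hreal, hD] at this
    have h2 := congrArg (starRingEnd ℂ) this
    simp only [Complex.conj_conj, map_mul, map_div₀, Complex.conj_ofReal] at h2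
    rw [h2]
    ring
  have hwj := eq_mul_of_annihilates hR hw
  set c := (∑ l, w l * (starRingEnd ℂ) (R l)) / (∑ l, Complex.normSq (R l) : ℝ) with hc
  have hcD : (c + (starRingEnd ℂ) c) * D = 1 := by
    have h1 : ∑ j, w j * a j = c * S := by
      rw [hS, Finset.mul_sum]
      exact Finset.sum_congr rfl fun j _ => by rw [hwj j]; ring
    have h2 : ∑ j, t j * b j = (starRingEnd ℂ) (c * S) := by
      rw [← h1, map_sum]
      exact Finset.sum_congr rfl fun j _ => by rw [ht', hb', map_mul]; ring
    rw [h1, h2, map_mul, hreal, hD] at hone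
    linear_combination hone
  refine ⟨D, hD, ?_, haj, fun j => ?_, c, rfl, hwj, fun j => ?_, hcD⟩
  · rintro rfl
    simp at hcD
  · rw [hb', haj]
    simp [-Complex.ofReal_sum]
  · rw [ht', hwj j, map_mul]

open Filter Topology

variable {ρ ρ₀ : Pt n → ℝ} {p : Pt n}

theorem fderiv_cR (h : DifferentiableAt ℝ ρ p) (u : Pt n) :
    fderiv ℝ (cR n ρ) p u = (fderiv ℝ ρ p u : ℂ) := by
  have : HasFDerivAt (cR n ρ) (Complex.ofRealCLM.comp (fderiv ℝ ρ p)) p :=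
    Complex.ofRealCLM.hasFDerivAt.comp p h.hasFDerivAt
  rw [this.fderiv]
  rfl

theorem dZb_cR_eq_conj (h : DifferentiableAt ℝ ρ p) (j : Fin n) :
    dZb n (cR n ρ) j p = (starRingEnd ℂ) (dZ n (cR n ρ) j p) := by
  simp only [dZ, dZb, fderiv_cR h, map_mul, map_sub, Complex.conj_ofReal, Complex.conj_I, map_div₀,
    map_one, map_ofNat]
  ring

theorem gradSq_ne_zero (h : fderiv ℝ ρ p ≠ 0) : gradSq n ρ p ≠ 0 := by
  have hd : DifferentiableAt ℝ ρ p := by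
    by_contra hd
    exact h (fderiv_zero_of_not_differentiableAt hd)
  contrapose! h
  have h0 : ∀ j, dZ n (cR n ρ) j p = 0 := fun j =>
    Complex.normSq_eq_zero.1
      ((Finset.sum_eq_zero_iff_of_nonneg fun j _ => Complex.normSq_nonneg _).1 h j
        (Finset.mem_univ j))
  ext1 u
  have := fderiv_apply_eq_vecApp (cR n ρ) p u
  rw [fderiv_cR hd] at this
  simpa [vecApp, h0, dZb_cR_eq_conj hd] using this

theorem dZ_cR_of_hasFDerivAt_smul {h : ℝ} (h₀ : DifferentiableAt ℝ ρ₀ p)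
    (hρ : HasFDerivAt ρ (h • fderiv ℝ ρ₀ p) p) (j : Fin n) :
    dZ n (cR n ρ) j p = h * dZ n (cR n ρ₀) j p := by
  simp only [dZ, fderiv_cR h₀, fderiv_cR hρ.differentiableAt, hρ.fderiv, smul_apply, smul_eq_mul,
    Complex.ofReal_mul]
  ring

theorem gradSq_of_hasFDerivAt_smul {h : ℝ} (h₀ : DifferentiableAt ℝ ρ₀ p)
    (hρ : HasFDerivAt ρ (h • fderiv ℝ ρ₀ p) p) : gradSq n ρ p = h ^ 2 * gradSq n ρ₀ p := by
  simp only [gradSq, dZ_cR_of_hasFDerivAt_smul h₀ hρ, map_mul, Complex.normSq_ofReal,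
    ← Finset.mul_sum]
  ring

theorem fderiv_half_eq_of_sum_eq (h : DifferentiableAt ℝ ρ p) {a : Pt n} {D : ℝ}
    (hD : ∑ j, a j * dZ n (cR n ρ) j p = D) : fderiv ℝ ρ p ((1 / 2 : ℝ) • a) = D := by
  have h1 := fderiv_apply_eq_vecApp (cR n ρ) p a
  have h2 := congrArg (starRingEnd ℂ) hD
  simp only [map_sum, map_mul, Complex.conj_ofReal, ← dZb_cR_eq_conj h] at h2
  rw [fderiv_cR h] at h1
  simp only [vecApp, conjVec] at h1
  rw [hD, h2] at h1
  have h3 : fderiv ℝ ρ p a = D + D := by exact_mod_cast h1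
  rw [map_smul, h3, smul_eq_mul]
  ring

theorem ofReal_gradSq (h : DifferentiableAt ℝ ρ p) :
    (gradSq n ρ p : ℂ) = ∑ j, dZ n (cR n ρ) j p * dZb n (cR n ρ) j p := by
  simp only [gradSq, Complex.ofReal_sum, dZb_cR_eq_conj h, Complex.mul_conj]

theorem contDiffAt_ofReal_gradSq (h : ContDiffAt ℝ 2 ρ p) :
    ContDiffAt ℝ 1 (fun z => (gradSq n ρ z : ℂ)) p := by
  have hcR : ContDiffAt ℝ 2 (cR n ρ) p := Complex.ofRealCLM.contDiff.contDiffAt.comp p h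
  have h1 : ContDiffAt ℝ 1 (fun z => ∑ j, dZ n (cR n ρ) j z * dZb n (cR n ρ) j z) p :=
    ContDiffAt.sum fun j _ => (contDiffAt_dZ hcR j).mul (contDiffAt_dZb hcR j)
  refine h1.congr_of_eventuallyEq ?_
  filter_upwards [h.eventually (by simp)] with z hz
  exact ofReal_gradSq (hz.differentiableAt (by simp))

theorem etaF_app_TVF (h : DifferentiableAt ℝ ρ p) (hρ' : fderiv ℝ ρ p ≠ 0) :
    Form1.app (etaF n ρ) (TVF n ρ) p = 1 := by
  have hG : (gradSq n ρ p : ℂ) ≠ 0 := Complex.ofReal_ne_zero.2 (gradSq_ne_zero hρ')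
  have hsum := ofReal_gradSq h
  simp only [Form1.app, Form1.eval, VF.atPt, etaF, TVF, LnVF, map_div₀, Complex.conj_ofReal]
  simp only [dZb_cR_eq_conj h, Complex.conj_conj] at hsum ⊢
  rw [← Finset.sum_add_distrib]
  have : ∀ j, (1 / 2 : ℂ) * dZ n (cR n ρ) j p *
        ((starRingEnd ℂ) (dZ n (cR n ρ) j p) / (gradSq n ρ p : ℂ)) +
      -(1 / 2) * (starRingEnd ℂ) (dZ n (cR n ρ) j p) *
        -(dZ n (cR n ρ) j p / (gradSq n ρ p : ℂ)) =
      dZ n (cR n ρ) j p * (starRingEnd ℂ) (dZ n (cR n ρ) j p) / (gradSq n ρ p : ℂ) :=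
    fun j => by ring
  simp only [this]
  rw [← Finset.sum_div, ← hsum, div_self hG]

end Frame

section DefiningFunctions

open Filter Topology

variable {n : ℕ} {s : ℕ∞} {Ω V : Set (Pt n)} {ρ : Pt n → ℝ} {p : Pt n}

theorem IsDefining.contDiffAt (h : IsDefining n s Ω ρ V) (hp : p ∈ frontier Ω) :
    ContDiffAt ℝ s ρ p :=
  h.2.2.1.contDiffAt (h.1.mem_nhds (h.2.1 (frontier_subset_closure hp)))

theorem IsDefining.eq_zero (h : IsDefining n s Ω ρ V) (hopen : IsOpen Ω) (hp : p ∈ frontier Ω) :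
    ρ p = 0 := by
  have hc : ContinuousAt ρ p := (h.contDiffAt hp).continuousAt
  rw [hopen.frontier_eq] at hp
  apply le_antisymm
  · have hmaps : Set.MapsTo ρ Ω (Set.Iic 0) := fun z hz => by
      rw [h.2.2.2.1] at hz
      exact hz.2.le
    have := hc.continuousWithinAt.mem_closure hp.1 hmaps
    rwa [isClosed_Iic.closure_eq] at this
  · by_contra hlt
    refine hp.2 ?_
    rw [h.2.2.2.1]
    exact ⟨h.2.1 hp.1, not_le.1 hlt⟩

theorem IsDefining.eventually_pos (h : IsDefining n s Ω ρ V) (hs : 1 ≤ s)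
    (hp : p ∈ frontier Ω) : ∀ᶠ z in 𝓝 p, z ∉ closure Ω → 0 < ρ z := by
  have hcont := h.contDiffAt hp
  have hne : ∀ᶠ z in 𝓝 p, fderiv ℝ ρ z ≠ 0 :=
    (hcont.continuousAt_fderiv (by
      exact_mod_cast (zero_lt_one.trans_le hs).ne')).eventually_ne (h.2.2.2.2 p hp)
  filter_upwards [hne, h.1.mem_nhds (h.2.1 (frontier_subset_closure hp))] with z hz hzV hzΩ
  have hnn : ∀ w ∈ V, w ∉ closure Ω → 0 ≤ ρ w := fun w hw hwΩ => by
    by_contra hlt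
    refine hwΩ (subset_closure ?_)
    rw [h.2.2.2.1]
    exact ⟨hw, not_le.1 hlt⟩
  refine lt_of_le_of_ne (hnn z hzV hzΩ) fun h0 => hz ?_
  have hmin : IsLocalMin ρ z := by
    filter_upwards [h.1.mem_nhds hzV, isClosed_closure.isOpen_compl.mem_nhds hzΩ] with w hw hwΩ
    rw [← h0]
    exact hnn w hw hwΩ
  exact hmin.fderiv_eq_zero

theorem IsDefining.eventually_mem_frontier (h : IsDefining n s Ω ρ V) (hs : 1 ≤ s)
    (hopen : IsOpen Ω) (hp : p ∈ frontier Ω) : ∀ᶠ z in 𝓝 p, ρ z = 0 → z ∈ frontier Ω := by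
  filter_upwards [h.eventually_pos hs hp] with z hz h0
  rw [hopen.frontier_eq]
  refine ⟨by_contra fun hzΩ => (hz hzΩ).ne' h0, fun hzΩ => ?_⟩
  rw [h.2.2.2.1] at hzΩ
  exact hzΩ.2.ne h0

/-- A defining function can be rescaled so that its derivative on the boundary is
`|dρ(v)|⁻¹ dρ`, without loss of smoothness, for any smooth transversal field `v`. -/
theorem IsDefining.exists_rescale {k : ℕ} (h : IsDefining n k Ω ρ V) (hk : 1 ≤ k)
    (hopen : IsOpen Ω) {v : Pt n → Pt n} (hv : ∀ p ∈ frontier Ω, ContDiffAt ℝ k v p)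
    (hne : ∀ p ∈ frontier Ω, fderiv ℝ ρ p (v p) ≠ 0) :
    ∃ r, IsDefining n k Ω r Set.univ ∧
      ∀ p ∈ frontier Ω, HasFDerivAt r (|fderiv ℝ ρ p (v p)|⁻¹ • fderiv ℝ ρ p) p := by
  have hk1 : (1 : ℕ∞) ≤ k := by exact_mod_cast hk
  have hk0 : (((k : ℕ∞)) : WithTop ℕ∞) ≠ 0 := by
    exact_mod_cast (Nat.one_le_iff_ne_zero.1 hk)
  obtain ⟨r, hr⟩ := exists_contDiff_of_local_defining (m := k) (Ω := Ω)
    (fun z => |fderiv ℝ ρ z (v z)|⁻¹ • fderiv ℝ ρ z) (fun p => by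
      by_cases hpc : p ∈ closure Ω
      swap
      · refine ⟨fun _ => 1, ?_⟩
        filter_upwards [isClosed_closure.isOpen_compl.mem_nhds hpc] with z hz
        exact ⟨contDiffAt_const, fun h => (hz (subset_closure h)).elim,
          fun h => (hz (frontier_subset_closure h)).elim, fun _ => one_pos⟩
      by_cases hpΩ : p ∈ Ω
      · refine ⟨fun _ => -1, ?_⟩
        filter_upwards [hopen.mem_nhds hpΩ] with z hz
        refine ⟨contDiffAt_const, fun _ => by norm_num, fun h => ?_,
          fun h => (h (subset_closure hz)).elim⟩
        rw [hopen.frontier_eq] at h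
        exact (h.2 hz).elim
      have hp : p ∈ frontier Ω := by rw [hopen.frontier_eq]; exact ⟨hpc, hpΩ⟩
      obtain ⟨σ, hσ, hpos⟩ : ∃ σ : ℝ, |σ| = 1 ∧ 0 < fderiv ℝ ρ p (σ • v p) := by
        rcases (hne p hp).lt_or_gt with hlt | hlt
        · exact ⟨-1, by simp, by simpa using hlt⟩
        · exact ⟨1, by simp, by simpa using hlt⟩
      have hcont := h.contDiffAt hp
      have hσv : ContDiffAt ℝ k (fun z => σ • v z) p := contDiffAt_const.fun_smul (hv p hp)
      obtain ⟨r, hr⟩ := exists_contDiffAt_transversal_parameter hk0 (by simp) hcont hσv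
        (h.eq_zero hopen hp) hpos
      have hposn : ∀ᶠ z in 𝓝 p, 0 < fderiv ℝ ρ z (σ • v z) :=
        ((hcont.continuousAt_fderiv hk0).clm_apply hσv.continuousAt).eventually
          (lt_mem_nhds hpos)
      refine ⟨r, ?_⟩
      filter_upwards [hr, hposn, h.eventually_pos hk1 hp] with z hz hzpos hzc
      refine ⟨hz.1, fun hzΩ => hz.2.1 ?_, fun hzf => ?_, fun hzΩ => hz.2.2.2 (hzc hzΩ)⟩
      · rw [h.2.2.2.1] at hzΩ
        exact hzΩ.2
      · obtain ⟨h0, hd⟩ := hz.2.2.1 (h.eq_zero hopen hzf)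
        refine ⟨h0, ?_⟩
        rwa [← abs_of_pos hzpos, map_smul, smul_eq_mul, abs_mul, hσ, one_mul] at hd)
  refine ⟨r, ⟨isOpen_univ, Set.subset_univ _, fun z _ => (hr z).1.contDiffWithinAt, ?_, ?_⟩,
    fun p hp => ((hr p).2.2.1 hp).2⟩
  · ext z
    refine ⟨fun hz => ⟨Set.mem_univ z, (hr z).2.1 hz⟩, fun hz => by_contra fun hzΩ => ?_⟩
    by_cases hzc : z ∈ closure Ω
    · exact hz.2.ne ((hr z).2.2.1 (by rw [hopen.frontier_eq]; exact ⟨hzc, hzΩ⟩)).1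
    · exact hz.2.not_gt ((hr z).2.2.2 hzc)
  · intro p hp
    rw [((hr p).2.2.1 hp).2.fderiv]
    exact smul_ne_zero (inv_ne_zero (abs_ne_zero.2 (hne p hp))) (h.2.2.2.2 p hp)

end DefiningFunctions

section DAngelo

open Filter Topology

variable {n : ℕ} {ρ : Pt n → ℝ} {p : Pt n} {X : (Fin n → ℂ) × (Fin n → ℂ)}

theorem Form1.eval_neg (η : Form1 n) : Form1.eval η.neg p X = -Form1.eval η p X := by
  simp only [Form1.eval, Form1.neg, neg_mul, Finset.sum_neg_distrib]
  ring

theorem dEval_smul_left (η : Form1 n) (c : ℂ) (A B : (Fin n → ℂ) × (Fin n → ℂ)) (p : Pt n) :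
    dEval η (c • A) B p = c * dEval η A B p := by
  simp only [dEval, delEval, delbEval, mul_add, Finset.mul_sum, Prod.smul_fst, Prod.smul_snd,
    Pi.smul_apply, smul_eq_mul]
  congr 2 <;> refine Finset.sum_congr rfl fun i _ => Finset.sum_congr rfl fun j _ => ?_ <;> ring

theorem contDiffAt_div_gradSq (h : ContDiffAt ℝ 2 ρ p) (hρ' : fderiv ℝ ρ p ≠ 0) {f : Pt n → ℂ}
    (hf : ContDiffAt ℝ 1 f p) : ContDiffAt ℝ 1 (fun z => f z / (gradSq n ρ z : ℂ)) p := by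
  simp only [div_eq_mul_inv]
  exact hf.mul ((contDiffAt_ofReal_gradSq h).inv (Complex.ofReal_ne_zero.2 (gradSq_ne_zero hρ')))

theorem contDiffAt_etaF (h : ContDiffAt ℝ 2 ρ p) (j : Fin n) :
    ContDiffAt ℝ 1 (fun z => (etaF n ρ).w z j) p ∧
      ContDiffAt ℝ 1 (fun z => (etaF n ρ).t z j) p := by
  have hcR : ContDiffAt ℝ 2 (cR n ρ) p := Complex.ofRealCLM.contDiff.contDiffAt.comp p h
  exact ⟨contDiffAt_const.mul (contDiffAt_dZ hcR j), contDiffAt_const.mul (contDiffAt_dZb hcR j)⟩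

theorem contDiffAt_TVF (h : ContDiffAt ℝ 2 ρ p) (hρ' : fderiv ℝ ρ p ≠ 0) (j : Fin n) :
    ContDiffAt ℝ 1 (fun z => (TVF n ρ).a z j) p ∧
      ContDiffAt ℝ 1 (fun z => (TVF n ρ).b z j) p := by
  have hcR : ContDiffAt ℝ 2 (cR n ρ) p := Complex.ofRealCLM.contDiff.contDiffAt.comp p h
  have ha : ContDiffAt ℝ 1 (fun z => (TVF n ρ).a z j) p :=
    contDiffAt_div_gradSq h hρ' (contDiffAt_dZb hcR j)
  exact ⟨ha, (Complex.conjCLE.contDiff.contDiffAt.comp p ha).neg⟩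

/-- Normal form of a pair `(η, T)` as in the definition of D'Angelo forms without reference to a
defining function. -/
theorem normal_form_at {η : Form1 n} {T : VF n} (hd : DifferentiableAt ℝ ρ p)
    (hρ' : fderiv ℝ ρ p ≠ 0)
    (hηim : ∀ j, (starRingEnd ℂ) (η.t p j) = -η.w p j)
    (hann : ∀ X ∈ T10 n ρ p, Form1.eval η p (X, 0) = 0)
    (hTim : ∀ j, (starRingEnd ℂ) (T.b p j) = -T.a p j)
    (hTtan : vecApp n (T.atPt p) (cR n ρ) p = 0)
    (hTorth : ∀ X ∈ T10 n ρ p, gMet (T.atPt p) (X, 0) = 0)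
    (hηT : Form1.app η T p = 1) :
    ∃ D : ℝ, fderiv ℝ ρ p ((1 / 2 : ℝ) • T.a p) = D ∧ D ≠ 0 ∧
      (∀ j, T.a p j = D * (starRingEnd ℂ) (dZ n (cR n ρ) j p) / gradSq n ρ p) ∧
      (∀ j, T.b p j = -(D * dZ n (cR n ρ) j p / gradSq n ρ p)) ∧
      ∃ c : ℂ, c = (∑ l, η.w p l * dZb n (cR n ρ) l p) / gradSq n ρ p ∧
        (∀ j, η.w p j = c * dZ n (cR n ρ) j p) ∧
        (∀ j, η.t p j = -((starRingEnd ℂ) c * dZb n (cR n ρ) j p)) ∧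
        (c + (starRingEnd ℂ) c) * D = 1 := by
  obtain ⟨D, hD, hD0, ha, hb, c, hc, hw, ht, hcD⟩ :=
    normal_form_of_annihilates (R := fun j => dZ n (cR n ρ) j p) (gradSq_ne_zero hρ') hηim hTim
      (fun X hX => by simpa [Form1.eval] using hann X hX)
      (fun X hX => by simpa [gMet, VF.atPt] using hTorth X hX)
      (by simpa [vecApp, VF.atPt, dZb_cR_eq_conj hd] using hTtan) hηT
  refine ⟨D, fderiv_half_eq_of_sum_eq hd hD, hD0, ha, hb, c, ?_, hw, ?_, hcD⟩
  · simpa only [dZb_cR_eq_conj hd, gradSq] using hc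
  · simpa only [dZb_cR_eq_conj hd] using ht

end DAngelo

/-- Remark after Definition 3.1: the defining-function-free definition of
D'Angelo 1-forms agrees with the one via defining functions: for any purely imaginary,
non-vanishing 1-form η on ∂Ω annihilating T^{1,0}(∂Ω) ⊕ T^{0,1}(∂Ω), with T_η the purely
imaginary tangential field orthogonal to T^{1,0} ⊕ T^{0,1} satisfying η(T_η) ≡ 1, there is
a defining function ρ with α_ρ = −Lie_{T_η} η as forms on ∂Ω. -/
theorem dAngelo_defining_function_free
    (n k : ℕ) (hn : 2 ≤ n) (hk : 3 ≤ k)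
    (Ω : Set (Pt n)) (hopen : IsOpen Ω) (hconn : IsConnected Ω)
    (hbdd : Bornology.IsBounded Ω)
    (ρ₀ : Pt n → ℝ) (V₀ : Set (Pt n)) (hdef₀ : IsDefining n (k : ℕ∞) Ω ρ₀ V₀)
    (hpsc : LeviPseudoconvex n ρ₀ Ω)
    (U : Set (Pt n)) (hU : IsOpen U) (hUfr : frontier Ω ⊆ U)
    (η : Form1 n) (T : VF n)
    (hηsm : ∀ j, ContDiffOn ℝ (⊤ : ℕ∞) (fun z => η.w z j) U ∧ ContDiffOn ℝ (⊤ : ℕ∞) (fun z => η.t z j) U)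
    (hTsm : ∀ j, ContDiffOn ℝ (⊤ : ℕ∞) (fun z => T.a z j) U ∧ ContDiffOn ℝ (⊤ : ℕ∞) (fun z => T.b z j) U)
    (hηim : ∀ p ∈ frontier Ω, ∀ j, (starRingEnd ℂ) (η.t p j) = -η.w p j)
    (hηnv : ∀ p ∈ frontier Ω, ¬(∀ j, η.w p j = 0 ∧ η.t p j = 0))
    (hann : ∀ p ∈ frontier Ω, ∀ X ∈ T10 n ρ₀ p,
      Form1.eval η p (X, 0) = 0 ∧ Form1.eval η p (0, conjVec X) = 0)
    (hTim : ∀ p ∈ frontier Ω, ∀ j, (starRingEnd ℂ) (T.b p j) = -T.a p j)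
    (hTtan : ∀ p ∈ frontier Ω,
      ∑ j, T.a p j * dZ n (cR n ρ₀) j p + ∑ j, T.b p j * dZb n (cR n ρ₀) j p = 0)
    (hTorth : ∀ p ∈ frontier Ω, ∀ X ∈ T10 n ρ₀ p,
      gMet (T.atPt p) (X, 0) = 0 ∧ gMet (T.atPt p) (0, conjVec X) = 0)
    (hηT : ∀ p ∈ frontier Ω, Form1.app η T p = 1) :
    ∃ ρ V, IsDefining n (k : ℕ∞) Ω ρ V ∧
      ∀ p ∈ frontier Ω, ∀ X : (Fin n → ℂ) × (Fin n → ℂ),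
        (∑ j, X.1 j * dZ n (cR n ρ₀) j p + ∑ j, X.2 j * dZb n (cR n ρ₀) j p = 0) →
        Form1.eval (dAngelo n ρ) p X = Form1.eval (Form1.neg (lieD T η)) p X := by
  have hk2 : (2 : WithTop ℕ∞) ≤ ((k : ℕ∞) : WithTop ℕ∞) := 
    WithTop.coe_le_coe.2 (by exact_mod_cast (by omega : 2 ≤ k) : (2 : ℕ∞) ≤ k)
  have hk1' : (1 : ℕ∞) ≤ k := by exact_mod_cast (by omega : 1 ≤ k)
  have hρ2 : ∀ p ∈ frontier Ω, ContDiffAt ℝ 2 ρ₀ p := fun p hp =>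
    (hdef₀.contDiffAt hp).of_le hk2
  have hd₀ : ∀ p ∈ frontier Ω, DifferentiableAt ℝ ρ₀ p := fun p hp =>
    (hρ2 p hp).differentiableAt two_ne_zero
  have hUn : ∀ p ∈ frontier Ω, U ∈ nhds p := fun p hp => hU.mem_nhds (hUfr hp)
  have hnf := fun p (hp : p ∈ frontier Ω) =>
    normal_form_at (hd₀ p hp) (hdef₀.2.2.2.2 p hp) (hηim p hp)
      (fun X hX => (hann p hp X hX).1) (hTim p hp) (hTtan p hp)
      (fun X hX => (hTorth p hp X hX).1) (hηT p hp)
  have hTa : ∀ p ∈ frontier Ω, ContDiffAt ℝ k (fun z => (1 / 2 : ℝ) • T.a z) p := fun p hp =>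
    contDiffAt_const.fun_smul (contDiffAt_pi.2 fun j =>
      ((hTsm j).1.contDiffAt (hUn p hp)).of_le (by exact_mod_cast le_top))
  obtain ⟨r, hr, hrd⟩ := hdef₀.exists_rescale (by omega) hopen hTa (fun p hp => by
    obtain ⟨D, hD, hD0, -⟩ := hnf p hp
    rwa [hD])
  refine ⟨r, Set.univ, hr, fun p hp X hX => ?_⟩
  have hr2 : ContDiffAt ℝ 2 r p := (hr.contDiffAt hp).of_le hk2
  have hρ1 := (hρ2 p hp).of_le one_le_two
  have hρp := hdef₀.eq_zero hopen hp
  have hρ' := hdef₀.2.2.2.2 p hp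
  have hev := hdef₀.eventually_mem_frontier hk1' hopen hp
  have h1 : (1 : WithTop ℕ∞) ≤ ((⊤ : ℕ∞) : WithTop ℕ∞) := by exact_mod_cast le_top
  have hηw := fun j => ((hηsm j).1.contDiffAt (hUn p hp)).of_le h1
  have hηt := fun j => ((hηsm j).2.contDiffAt (hUn p hp)).of_le h1
  rw [dAngelo, Form1.eval_neg, Form1.eval_neg, neg_inj,
    eval_lieD_eq_dEval hρ1 hρp hρ' (fun j => (contDiffAt_etaF hr2 j).1)
      (fun j => (contDiffAt_etaF hr2 j).2)
      (fun j => (contDiffAt_TVF hr2 (hr.2.2.2.2 p hp) j).1)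
      (fun j => (contDiffAt_TVF hr2 (hr.2.2.2.2 p hp) j).2)
      (hev.mono fun z hz h0 =>
        etaF_app_TVF (hrd z (hz h0)).differentiableAt (hr.2.2.2.2 z (hz h0))) hX,
    eval_lieD_eq_dEval hρ1 hρp hρ' hηw hηt
      (fun j => ((hTsm j).1.contDiffAt (hUn p hp)).of_le h1)
      (fun j => ((hTsm j).2.contDiffAt (hUn p hp)).of_le h1)
      (hev.mono fun z hz h0 => hηT z (hz h0)) hX]
  obtain ⟨ε, hε, hpos⟩ : ∃ ε : ℝ, ε * ε = 1 ∧
      0 < ε * fderiv ℝ ρ₀ p ((1 / 2 : ℝ) • T.a p) := by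
    obtain ⟨D, hD, hD0, -⟩ := hnf p hp
    rw [hD]
    rcases hD0.lt_or_gt with hlt | hlt
    · exact ⟨-1, by norm_num, by linarith⟩
    · exact ⟨1, by norm_num, by linarith⟩
  have hscale : ∀ᶠ z in nhds p, ∀ D : ℝ, fderiv ℝ ρ₀ z ((1 / 2 : ℝ) • T.a z) = D →
      |fderiv ℝ ρ₀ z ((1 / 2 : ℝ) • T.a z)|⁻¹ = ε * D⁻¹ := by
    have hcont : ContinuousAt (fun z => ε * fderiv ℝ ρ₀ z ((1 / 2 : ℝ) • T.a z)) p :=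
      continuousAt_const.mul (((hρ2 p hp).continuousAt_fderiv two_ne_zero).clm_apply
        (hTa p hp).continuousAt)
    filter_upwards [hcont.eventually (lt_mem_nhds hpos)] with z hz D hD
    rw [hD] at hz ⊢
    have hD0 : D ≠ 0 := by
      rintro rfl
      simp at hz
    have : |D| = ε * D := by
      rcases mul_self_eq_one_iff.1 hε with rfl | rfl
      · rw [one_mul] at hz ⊢
        exact abs_of_pos hz
      · rw [neg_one_mul] at hz ⊢
        exact abs_of_neg (by linarith)
    rw [this, mul_inv, inv_eq_of_mul_eq_one_right hε]
  have hεC : (ε : ℂ) * ε = 1 := by exact_mod_cast hε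
  have hTp : (TVF n r).atPt p = (ε : ℂ) • T.atPt p := by
    obtain ⟨D, hD, hD0, ha, hb, -⟩ := hnf p hp
    have hrp := hrd p hp
    rw [hscale.self_of_nhds D hD] at hrp
    have hG : (gradSq n ρ₀ p : ℂ) ≠ 0 := Complex.ofReal_ne_zero.2 (gradSq_ne_zero hρ')
    have hDC : (D : ℂ) ≠ 0 := Complex.ofReal_ne_zero.2 hD0
    have hεC0 : (ε : ℂ) ≠ 0 := left_ne_zero_of_mul_eq_one hεC
    have hLn : ∀ j, (LnVF n r).a p j =
        ε * (D * (starRingEnd ℂ) (dZ n (cR n ρ₀) j p) / gradSq n ρ₀ p) := by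
      intro j
      simp only [LnVF, dZb_cR_eq_conj hrp.differentiableAt,
        dZ_cR_of_hasFDerivAt_smul (hd₀ p hp) hrp, gradSq_of_hasFDerivAt_smul (hd₀ p hp) hrp,
        map_mul, map_inv₀, Complex.conj_ofReal, Complex.ofReal_mul, Complex.ofReal_pow,
        Complex.ofReal_inv]
      field_simp
      linear_combination -(starRingEnd ℂ) (dZ n (cR n ρ₀) j p) * hεC
    ext j
    · simpa [VF.atPt, TVF, ha] using hLn j
    · simp [VF.atPt, TVF, hb, hLn]
  have hcR : ContDiffAt ℝ 2 (cR n ρ₀) p :=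
    Complex.ofRealCLM.contDiff.contDiffAt.comp p (hρ2 p hp)
  obtain ⟨C, hC⟩ : ∃ C : Pt n → ℂ,
      C = fun z => (∑ l, η.w z l * dZb n (cR n ρ₀) l z) / (gradSq n ρ₀ z : ℂ) := ⟨_, rfl⟩
  have hCp : ContDiffAt ℝ 1 C p := by
    rw [hC]
    exact contDiffAt_div_gradSq (hρ2 p hp) hρ'
      (ContDiffAt.sum fun l _ => (hηw l).mul (contDiffAt_dZb hcR l))
  rw [hTp, dEval_smul_left]
  refine (dEval_eq_of_eq_add_mul (hρ2 p hp) hρp hρ' (ε : ℂ) hηw hηt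
    (fun j => (contDiffAt_etaF hr2 j).1) (fun j => (contDiffAt_etaF hr2 j).2)
    (g := fun z => (C z - (starRingEnd ℂ) (C z)) / 2)
    ((hCp.sub (Complex.conjCLE.contDiff.contDiffAt.comp p hCp)).div_const 2) ?_
    (A := T.atPt p) (hTtan p hp) hX).symm
  filter_upwards [hev, hscale] with z hz hsz h0 j
  have hzf := hz h0
  obtain ⟨D, hD, -, -, -, c, hc', hw, ht, hcD⟩ := hnf z hzf
  have hrz := hrd z hzf
  rw [hsz D hD] at hrz
  have hcC : C z = c := by rw [hC, hc']
  have hcD' : c + (starRingEnd ℂ) c = (D : ℂ)⁻¹ := eq_inv_of_mul_eq_one_left hcD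
  simp only [hcC, etaF, dZb_cR_eq_conj hrz.differentiableAt,
    dZ_cR_of_hasFDerivAt_smul (hd₀ z hzf) hrz, hw, ht, dZb_cR_eq_conj (hd₀ z hzf), map_mul,
    Complex.conj_ofReal, Complex.ofReal_mul, Complex.ofReal_inv, ← hcD', map_add, Complex.conj_conj]
  constructor
  · linear_combination -(1 / 2 : ℂ) * (c + (starRingEnd ℂ) c) * dZ n (cR n ρ₀) j z * hεC
  · linear_combination (1 / 2 : ℂ) * (c + (starRingEnd ℂ) c) *
      (starRingEnd ℂ) (dZ n (cR n ρ₀) j z) * hεC
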